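/- Let K be a field, let O_v ⊆ O_{v0} be valuation subrings of K, let Kv0 denote the residue field of O_{v0}, and let Ō_v denote the image of O_v in Kv0 (a valuation subring of Kv0). Then (K, O_v) is defectless if and only if both (K, O_{v0}) and (Kv0, Ō_v) are defectless. -/

import Mathlib

variable {K : Type*} [Field K] {L : Type*} [Field L]

/-- The ring homomorphism between valuation subrings induced by a field embedding,
when the lower valuation subring is the pullback of the upper one. -/
def prolongHom (f : K →+* L) (Ov : ValuationSubring K) (Ow : ValuationSubring L)
    (h : Ow.comap f = Ov) : Ov →+* Ow where
  toFun x := ⟨f x, by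
    have hx : (x : K) ∈ Ow.comap f := by rw [h]; exact x.2
    exact ValuationSubring.mem_comap.mp hx⟩
  map_one' := by ext; simp
  map_mul' x y := by ext; simp
  map_zero' := by ext; simp
  map_add' x y := by ext; simp

theorem prolongHom_isLocalHom (f : K →+* L) (Ov : ValuationSubring K)
    (Ow : ValuationSubring L) (h : Ow.comap f = Ov) :
    IsLocalHom (prolongHom f Ov Ow h) := by
  constructor
  intro a ha
  rcases isUnit_iff_exists_inv.mp ha with ⟨b, hb⟩
  have hb' : f a * (b : L) = 1 := congrArg Subtype.val hb
  have hfa : f (a : K) ≠ 0 := left_ne_zero_of_mul_eq_one hb'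
  have ha0 : (a : K) ≠ 0 := by
    intro h0
    exact hfa (by rw [h0, map_zero])
  have hbeq : (b : L) = f ((a : K)⁻¹) := by
    rw [map_inv₀]
    exact eq_inv_of_mul_eq_one_right hb'
  have hmem : (a : K)⁻¹ ∈ Ov := by
    have hm : (a : K)⁻¹ ∈ Ow.comap f := ValuationSubring.mem_comap.mpr (hbeq ▸ b.2)
    rwa [h] at hm
  refine isUnit_iff_exists_inv.mpr ⟨⟨(a : K)⁻¹, hmem⟩, ?_⟩
  ext
  simp [mul_inv_cancel₀ ha0]

/-- The induced embedding of residue fields. -/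
noncomputable def residueFieldMap (f : K →+* L) (Ov : ValuationSubring K)
    (Ow : ValuationSubring L) (h : Ow.comap f = Ov) :
    IsLocalRing.ResidueField Ov →+* IsLocalRing.ResidueField Ow :=
  haveI := prolongHom_isLocalHom f Ov Ow h
  IsLocalRing.ResidueField.map (prolongHom f Ov Ow h)

/-- The ramification index `e(w/v)`: the index of the image of `Kˣ/Ovˣ` in `Lˣ/Owˣ`. -/
noncomputable def ramificationIndex (f : K →+* L) (Ow : ValuationSubring L) : ℕ :=
  ((QuotientGroup.mk' Ow.unitGroup).comp (Units.map (f : K →* L))).range.index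

open scoped Classical in
/-- The inertia degree `f(w/v)`: the degree of the residue field extension. -/
noncomputable def inertiaDegree (f : K →+* L) (Ov : ValuationSubring K)
    (Ow : ValuationSubring L) : ℕ :=
  if h : Ow.comap f = Ov then
    @Module.finrank (IsLocalRing.ResidueField Ov) (IsLocalRing.ResidueField Ow) _ _
      (residueFieldMap f Ov Ow h).toModule
  else 0

/-- The set of prolongations of a valuation subring of `K` to `L`. -/
def prolongations (Ov : ValuationSubring K) (L : Type*) [Field L] [Algebra K L] :
    Set (ValuationSubring L) :=
  {Ow | Ow.comap (algebraMap K L) = Ov}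

/-- The fundamental equality for the extension `L/K`. -/
def FundamentalEquality (Ov : ValuationSubring K) (L : Type*) [Field L] [Algebra K L] : Prop :=
  (prolongations Ov L).Finite ∧
    Module.finrank K L =
      ∑ᶠ Ow ∈ prolongations Ov L,
        ramificationIndex (algebraMap K L) Ow * inertiaDegree (algebraMap K L) Ov Ow

/-- A valued field is defectless if the fundamental equality holds for every
finite extension. -/
def IsDefectless {K : Type u} [Field K] (Ov : ValuationSubring K) : Prop :=
  ∀ (L : Type u) [Field L] [Algebra K L], FiniteDimensional K L →
    FundamentalEquality Ov L

/-- A valued field is separably defectless if the fundamental equality holds for every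
finite separable extension. -/
def IsSeparablyDefectless {K : Type u} [Field K] (Ov : ValuationSubring K) : Prop :=
  ∀ (L : Type u) [Field L] [Algebra K L], FiniteDimensional K L →
    Algebra.IsSeparable K L → FundamentalEquality Ov L

open Finset in
theorem Valuation.exists_forall_dvd_geom_sum_eq_one {Γ₀ : Type*}
    [LinearOrderedCommGroupWithZero Γ₀] (v : Valuation L Γ₀) (b : L) (hb : v b ≤ 1) :
    ∃ m > 0, ∀ M, m ∣ M → v (∑ j ∈ range (M + 1), b ^ j) = 1 := by
  have hint : ∀ n : ℕ, v (n : L) ≤ 1 := fun n => by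
    induction n with
    | zero => simp
    | succ n ih => push_cast; exact v.map_add_le ih (by simp)
  have hpow : ∀ j, v (b ^ j) ≤ 1 := fun j => by rw [map_pow]; exact pow_le_one' hb j
  have hgeom : ∀ c : L, v c ≤ 1 → ∀ n, v (∑ j ∈ range n, c ^ j) ≤ 1 := fun c hc n =>
    v.map_sum_le fun j _ => by rw [map_pow]; exact pow_le_one' hc j
  obtain ⟨m, hm, hm'⟩ : ∃ m > 0, ∀ M, m ∣ M → ∀ k > 0, v (b ^ k - 1) < 1 →
      v (b ^ M - 1) < 1 := by
    by_cases h : ∃ k > 0, v (b ^ k - 1) < 1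
    · obtain ⟨k, hk, hk'⟩ := h
      refine ⟨k, hk, ?_⟩
      rintro _ ⟨t, rfl⟩ - - -
      rw [pow_mul, ← mul_geom_sum, map_mul]
      exact mul_lt_one_of_lt_of_le hk' (hgeom _ (hpow _) _)
    · exact ⟨1, one_pos, fun M _ k hk hk' => (h ⟨k, hk, hk'⟩).elim⟩
  obtain ⟨p, hp, hp'⟩ : ∃ p > 0, ∀ M : ℕ, p ∣ M → v ((M + 1 : ℕ) : L) = 1 := by
    by_cases h : ∃ p : ℕ, p > 0 ∧ v (p : L) < 1
    · obtain ⟨p, hp, hp'⟩ := h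
      refine ⟨p, hp, ?_⟩
      rintro _ ⟨t, rfl⟩
      push_cast
      rw [add_comm]
      refine v.map_one_add_of_lt ?_
      rw [map_mul]
      exact mul_lt_one_of_lt_of_le hp' (hint t)
    · push Not at h
      exact ⟨1, one_pos, fun M _ => le_antisymm (hint _) (h _ M.succ_pos)⟩
  refine ⟨m * p, Nat.mul_pos hm hp, fun M hM => le_antisymm (hgeom b hb _) ?_⟩
  by_contra! hlt
  have h1 : v (b ^ (M + 1) - 1) < 1 := by
    rw [← mul_geom_sum, map_mul]
    refine mul_lt_one_of_nonneg_of_lt_one_right (v.map_sub_le hb (by simp)) zero_le hlt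
  have h2 : v (b ^ M - 1) < 1 := hm' M (dvd_of_mul_right_dvd hM) _ M.succ_pos h1
  have h3 : v (b - 1) < 1 := by
    have : b - 1 = (b ^ (M + 1) - 1) - b * (b ^ M - 1) := by ring
    rw [this]
    refine v.map_sub_lt h1 ?_
    rw [map_mul]
    exact mul_lt_one_of_nonneg_of_lt_one_right hb zero_le h2
  have h4 : v (∑ j ∈ range (M + 1), (b ^ j - 1)) < 1 := by
    refine v.map_sum_lt' zero_lt_one fun j _ => ?_
    rw [← mul_geom_sum, map_mul]
    exact mul_lt_one_of_lt_of_le h3 (hgeom b hb _)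
  have h5 : ((M + 1 : ℕ) : L) =
      ∑ j ∈ range (M + 1), b ^ j - ∑ j ∈ range (M + 1), (b ^ j - 1) := by
    rw [sum_sub_distrib]; simp
  have h6 := v.map_sub_lt hlt h4
  rw [← h5, hp' M (dvd_of_mul_left_dvd hM)] at h6
  exact lt_irrefl _ h6

open Finset in
/-- Given `b` that is large at the `i`-th and small at the `l`-th of finitely many valuations,
one finds an element which is close to `1` at `i`, small at `l`, and integral everywhere. -/
theorem Valuation.exists_sub_one_lt_one_of_one_lt {Γ₀ : Type*}
    [LinearOrderedCommGroupWithZero Γ₀] {ι : Type*} [Finite ι] (V : ι → Valuation L Γ₀)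
    {i l : ι} {b : L} {γ : Γ₀} (hγ : γ ≤ 1) (hi : 1 < V i b) (hl : V l b < γ) :
    ∃ a, V i (a - 1) < 1 ∧ V l a < γ ∧ ∀ k, V k a ≤ 1 := by
  classical
  cases nonempty_fintype ι
  have key : ∀ k, ∃ m > 0, ∀ M, m ∣ M → V k b ≤ 1 →
      V k (∑ j ∈ range (M + 1), b ^ j) = 1 := by
    intro k
    by_cases hk : V k b ≤ 1
    · obtain ⟨m, hm, h⟩ := (V k).exists_forall_dvd_geom_sum_eq_one b hk
      exact ⟨m, hm, fun M hM _ => h M hM⟩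
    · exact ⟨1, one_pos, fun _ _ h => (hk h).elim⟩
  choose m hm hm' using key
  set M := ∏ k, m k with hM
  have hMpos : 0 < M := prod_pos fun k _ => hm k
  set s := ∑ j ∈ range (M + 1), b ^ j with hs
  have hsmall : ∀ k, V k b ≤ 1 → V k s = 1 := fun k hk =>
    hm' k M (dvd_prod_of_mem _ (mem_univ k)) hk
  have hlow : ∀ k, 1 < V k b → V k (s - b ^ M) < V k (b ^ M) := by
    intro k hk
    rw [hs, sum_range_succ, add_sub_cancel_right]
    have h0 : (0 : Γ₀) < V k b := zero_lt_one.trans hk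
    refine (V k).map_sum_lt' (by rw [map_pow]; exact pow_pos h0 _) fun j hj => ?_
    rw [map_pow, map_pow]
    exact pow_lt_pow_right₀ hk (mem_range.mp hj)
  have hlarge : ∀ k, 1 < V k b → V k s = V k (b ^ M) := fun k hk =>
    (V k).map_eq_of_sub_lt (hlow k hk)
  have hbM : ∀ k, 1 < V k b → 0 < V k (b ^ M) := fun k hk => by
    rw [map_pow]; exact pow_pos (zero_lt_one.trans hk) _
  have hs0 : s ≠ 0 := by
    rw [← (V i).ne_zero_iff, hlarge i hi]
    exact (hbM i hi).ne'
  refine ⟨b ^ M / s, ?_, ?_, fun k => ?_⟩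
  · have : b ^ M / s - 1 = -((s - b ^ M) / s) := by field_simp; ring
    rw [this, Valuation.map_neg, map_div₀, hlarge i hi]
    exact (div_lt_one₀ (hbM i hi)).mpr (hlow i hi)
  · have hl1 : V l b ≤ 1 := hl.le.trans hγ
    rw [map_div₀, hsmall l hl1, div_one, map_pow]
    exact (pow_le_of_le_one zero_le hl1 hMpos.ne').trans_lt hl
  · rcases le_or_gt (V k b) 1 with hk | hk
    · rw [map_div₀, hsmall k hk, div_one, map_pow]
      exact pow_le_one' hk _
    · rw [map_div₀, hlarge k hk, div_self (hbM k hk).ne']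

/-- Approximation for finitely many incomparable, possibly dependent, valuations with a common
restriction to a subfield modulo which their value groups are torsion. -/
theorem Valuation.exists_sub_lt_and_forall_lt {Γ₀ : Type*}
    [LinearOrderedCommGroupWithZero Γ₀] {ι : Type*} [Finite ι] (V : ι → Valuation L Γ₀)
    (f : K →+* L) (hf : ∀ i j c, V i (f c) = V j (f c))
    (htors : ∀ i x, ∃ N > 0, ∃ c, V i (x ^ N) = V i (f c))
    (hinc : ∀ i j, i ≠ j → ∃ b, 1 < V i b ∧ V j b < 1) (i : ι) {x : L} (hx : x ≠ 0) :
    ∃ z, V i (z - x) < V i x ∧ ∀ l, l ≠ i → V l z < V i x := by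
  classical
  cases nonempty_fintype ι
  have hx0 : ∀ k, 0 < V k x := fun k => zero_lt_iff.mpr ((V k).ne_zero_iff.mpr hx)
  have key : ∀ l, ∃ a, V i (a - 1) < 1 ∧ (∀ k, V k a ≤ 1) ∧
      (l ≠ i → V l a < V i x / V l x) := by
    intro l
    by_cases hl : l = i
    · exact ⟨1, by simp, by simp, fun h => (h hl).elim⟩
    obtain ⟨b, hbi, hbl⟩ := hinc i l (Ne.symm hl)
    obtain ⟨a, h1, h2, h3⟩ : ∃ a, V i (a - 1) < 1 ∧ V l a < min 1 (V i x / V l x) ∧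
        ∀ k, V k a ≤ 1 := by
      rcases lt_or_ge (V l x) (V i x) with h | h
      · refine Valuation.exists_sub_one_lt_one_of_one_lt V (min_le_left _ _) hbi ?_
        exact lt_min hbl (hbl.trans ((one_lt_div₀ (hx0 l)).mpr h))
      · have hγ1 : V i x / V l x ≤ 1 := (div_le_one₀ (hx0 l)).mpr h
        have hγ0 : 0 < V i x / V l x := div_pos (hx0 i) (hx0 l)
        obtain ⟨N, hN, c, hc⟩ := htors i x
        refine Valuation.exists_sub_one_lt_one_of_one_lt V (b := b * (f c / x ^ N))
          (min_le_left _ _) ?_ ?_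
        · rw [map_mul, map_div₀, ← hc, div_self, mul_one]
          · exact hbi
          · rw [map_pow]; exact (pow_pos (hx0 i) _).ne'
        · rw [min_eq_right hγ1, map_mul, map_div₀, hf l i c, ← hc, map_pow, map_pow, ← div_pow]
          calc V l b * (V i x / V l x) ^ N ≤ V l b * (V i x / V l x) := by
                gcongr
                exact pow_le_of_le_one zero_le hγ1 hN.ne'
            _ < 1 * (V i x / V l x) := by gcongr
            _ = _ := one_mul _
    exact ⟨a, h1, h3, fun _ => h2.trans_le (min_le_right _ _)⟩
  choose a ha1 ha2 ha3 using key
  have hprod : ∀ s : Finset ι, V i (∏ l ∈ s, a l - 1) < 1 := by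
    intro s
    induction s using Finset.induction_on with
    | empty => simp
    | insert l s hl ih =>
      rw [Finset.prod_insert hl]
      have : a l * ∏ l ∈ s, a l - 1 = a l * (∏ l ∈ s, a l - 1) + (a l - 1) := by ring
      rw [this]
      refine (V i).map_add_lt ?_ (ha1 l)
      rw [map_mul]
      exact mul_lt_one_of_nonneg_of_lt_one_right (ha2 l i) zero_le ih
  refine ⟨(∏ l, a l) * x, ?_, fun l hl => ?_⟩
  · have : (∏ l, a l) * x - x = (∏ l, a l - 1) * x := by ring
    rw [this, map_mul]
    exact mul_lt_of_lt_one_left (hx0 i) (hprod _)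
  · rw [map_mul, ← lt_div_iff₀ (hx0 l), map_prod]
    refine lt_of_le_of_lt ?_ (ha3 l hl)
    rw [← Finset.mul_prod_erase _ _ (Finset.mem_univ l)]
    exact mul_le_of_le_one_right zero_le (Finset.prod_le_one' fun k _ => ha2 k l)

theorem Valuation.map_le_map_sum_of_injective {Γ₀ : Type*} [LinearOrderedCommGroupWithZero Γ₀]
    (v : Valuation L Γ₀) {ι : Type*} [Fintype ι] (t : ι → L)
    (ht : ∀ i j, v (t i) = v (t j) → v (t i) ≠ 0 → i = j) (i : ι) :
    v (t i) ≤ v (∑ j, t j) := by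
  classical
  obtain ⟨k, -, hk⟩ := Finset.exists_max_image Finset.univ (fun j => v (t j)) ⟨i, Finset.mem_univ i⟩
  rcases eq_or_ne (v (t k)) 0 with h0 | h0
  · have := hk i (Finset.mem_univ i)
    rw [h0] at this
    exact this.trans zero_le
  · rw [v.map_sum_eq_of_lt (Finset.mem_univ k)]
    · exact hk i (Finset.mem_univ i)
    · intro j hj
      refine lt_of_le_of_ne (hk j (Finset.mem_univ j)) fun h => ?_
      simp only [Finset.mem_sdiff, Finset.mem_singleton] at hj
      exact hj.2 (ht k j h.symm h0).symm

theorem Valuation.exists_map_pow_factorial_eq {Γ₀ : Type*} [LinearOrderedCommGroupWithZero Γ₀]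
    [Algebra K L] [FiniteDimensional K L] (v : Valuation L Γ₀) (x : L) :
    ∃ c : K, v (x ^ (Module.finrank K L).factorial) = v (algebraMap K L c) := by
  rcases eq_or_ne x 0 with rfl | hx
  · exact ⟨0, by simp [Nat.factorial_ne_zero]⟩
  set n := Module.finrank K L with hn
  have hdep : ¬ LinearIndependent K (fun i : Fin (n + 1) => x ^ (i : ℕ)) := fun h => by
    have := h.fintype_card_le_finrank
    rw [Fintype.card_fin, ← hn] at this
    omega
  rw [Fintype.not_linearIndependent_iff] at hdep
  obtain ⟨g, hg, i, hi⟩ := hdep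
  have hxv : v x ≠ 0 := v.ne_zero_iff.mpr hx
  have hex : ∃ i j : Fin (n + 1), v (g i • x ^ (i : ℕ)) = v (g j • x ^ (j : ℕ)) ∧
      v (g i • x ^ (i : ℕ)) ≠ 0 ∧ (i : ℕ) < j := by
    by_contra! hcon
    have := v.map_le_map_sum_of_injective (fun i : Fin (n + 1) => g i • x ^ (i : ℕ))
      (fun i j h h0 => by
        rcases lt_trichotomy (i : ℕ) j with hlt | heq | hgt
        · exact (not_lt.mpr (hcon i j h h0) hlt).elim
        · exact Fin.ext heq
        · exact (not_lt.mpr (hcon j i h.symm (h ▸ h0)) hgt).elim) i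
    rw [hg, map_zero, le_zero_iff, v.zero_iff, smul_eq_zero] at this
    exact this.elim hi (pow_ne_zero _ hx)
  obtain ⟨i, j, hij, h0, hlt⟩ := hex
  obtain ⟨t, ht⟩ : ((j : ℕ) - i) ∣ n.factorial :=
    Nat.dvd_factorial (by omega) (by have := j.2; omega)
  have hgj : v (algebraMap K L (g j)) ≠ 0 := fun h => by
    rw [hij, Algebra.smul_def, map_mul, h, zero_mul] at h0
    exact h0 rfl
  refine ⟨(g i / g j) ^ t, ?_⟩
  have h1 : v (x ^ ((j : ℕ) - i)) = v (algebraMap K L (g i / g j)) := by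
    rw [map_div₀, map_div₀, eq_div_iff hgj]
    apply mul_right_cancel₀ (pow_ne_zero (i : ℕ) hxv)
    rw [Algebra.smul_def, Algebra.smul_def, map_mul, map_mul, map_pow, map_pow] at hij
    rw [hij, map_pow, mul_right_comm, ← pow_add, Nat.sub_add_cancel hlt.le, mul_comm]
  rw [ht, pow_mul, map_pow, h1, map_pow, map_pow]

theorem ValuationSubring.valuation_le_iff_of_comap_eq {f : K →+* L} {Ov : ValuationSubring K}
    {Ow : ValuationSubring L} (h : Ow.comap f = Ov) {a b : K} :
    Ow.valuation (f a) ≤ Ow.valuation (f b) ↔ Ov.valuation a ≤ Ov.valuation b := by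
  rcases eq_or_ne b 0 with rfl | hb
  · simp
  · have h1 : 0 < Ow.valuation (f b) := zero_lt_iff.mpr (by simpa using hb)
    have h2 : 0 < Ov.valuation b := zero_lt_iff.mpr (by simpa using hb)
    rw [← div_le_one₀ h1, ← div_le_one₀ h2, ← map_div₀, ← map_div₀, ← map_div₀,
      valuation_le_one_iff, valuation_le_one_iff, ← h, mem_comap]

theorem ValuationSubring.valuation_lt_iff_of_comap_eq {f : K →+* L} {Ov : ValuationSubring K}
    {Ow : ValuationSubring L} (h : Ow.comap f = Ov) {a b : K} :
    Ow.valuation (f a) < Ow.valuation (f b) ↔ Ov.valuation a < Ov.valuation b := by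
  rw [← not_le, ← not_le, valuation_le_iff_of_comap_eq h]

theorem ValuationSubring.valuation_eq_iff_of_comap_eq {f : K →+* L} {Ov : ValuationSubring K}
    {Ow : ValuationSubring L} (h : Ow.comap f = Ov) {a b : K} :
    Ow.valuation (f a) = Ow.valuation (f b) ↔ Ov.valuation a = Ov.valuation b := by
  rw [le_antisymm_iff, le_antisymm_iff, valuation_le_iff_of_comap_eq h,
    valuation_le_iff_of_comap_eq h]

/-- All prolongations of a valuation to a finite extension can be rescaled to take values in the
value group of the base field. -/
theorem ValuationSubring.exists_valuation_of_comap_eq [Algebra K L] [FiniteDimensional K L]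
    {Ov : ValuationSubring K} {Ow : ValuationSubring L} (h : Ow.comap (algebraMap K L) = Ov) :
    ∃ V : Valuation L Ov.ValueGroup, (∀ x y, V x ≤ V y ↔ Ow.valuation x ≤ Ow.valuation y) ∧
      ∀ c, V (algebraMap K L c) = Ov.valuation c ^ (Module.finrank K L).factorial := by
  set N := (Module.finrank K L).factorial with hN
  have hN0 : N ≠ 0 := Nat.factorial_ne_zero _
  choose c hc using fun x : L => Ow.valuation.exists_map_pow_factorial_eq (K := K) x
  rw [← hN] at hc
  have hle : ∀ x y, Ov.valuation (c x) ≤ Ov.valuation (c y) ↔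
      Ow.valuation x ≤ Ow.valuation y := fun x y => by
    rw [← valuation_le_iff_of_comap_eq h, ← hc, ← hc, map_pow, map_pow]
    exact pow_le_pow_iff_left₀ zero_le zero_le hN0
  have heq : ∀ x (d : K), Ow.valuation (x ^ N) = Ow.valuation (algebraMap K L d) →
      Ov.valuation (c x) = Ov.valuation d := fun x d hd => by
    rw [← valuation_eq_iff_of_comap_eq h, ← hc, hd]
  let V : Valuation L Ov.ValueGroup :=
    { toFun := fun x => Ov.valuation (c x)
      map_zero' := by rw [heq 0 0 (by simp [hN0]), map_zero]
      map_one' := by rw [heq 1 1 (by simp), map_one]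
      map_mul' := fun x y => by
        rw [heq (x * y) (c x * c y), map_mul]
        rw [mul_pow, map_mul, hc, hc, map_mul, map_mul]
      map_add_le_max' := fun x y => by
        rw [le_max_iff, hle, hle, ← le_max_iff]
        exact Ow.valuation.map_add x y }
  refine ⟨V, hle, fun d => ?_⟩
  change Ov.valuation (c _) = _
  rw [heq (algebraMap K L d) (d ^ N) (by rw [map_pow (algebraMap K L)]), map_pow]

theorem ValuationSubring.eq_of_le_of_comap_eq [Algebra K L] [FiniteDimensional K L]
    {A B : ValuationSubring L} (hle : A ≤ B)
    (h : A.comap (algebraMap K L) = B.comap (algebraMap K L)) : A = B := by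
  refine le_antisymm hle fun x hx => ?_
  obtain ⟨c, hc⟩ := A.valuation.exists_map_pow_factorial_eq (K := K) x
  set N := (Module.finrank K L).factorial with hN
  have hN0 : N ≠ 0 := Nat.factorial_ne_zero _
  have hcB : algebraMap K L c ∈ B := by
    obtain ⟨a, ha⟩ := (A.valuation_eq_iff _ _).mp hc.symm
    rw [← ha]
    exact B.mul_mem _ _ (hle (a : A).2) (pow_mem hx _)
  have hcA : algebraMap K L c ∈ A := by
    rwa [← mem_comap, h, mem_comap]
  rw [← valuation_le_one_iff] at hcA ⊢
  rw [← hc, map_pow] at hcA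
  exact (pow_le_one_iff hN0).mp hcA

/-- Products of elements with values in distinct cosets and units with independent residues are
valuation independent. -/
theorem Valuation.map_smul_mul_le_map_sum {Γ₀ : Type*} [LinearOrderedCommGroupWithZero Γ₀]
    [Algebra K L] (v : Valuation L Γ₀) {J κ : Type*} [Fintype J] [Fintype κ]
    (x : J → L) (y : κ → L)
    (hx : ∀ j j' (c : K), v (x j) = v (c • x j') → j = j') (hyle : ∀ k, v (y k) ≤ 1)
    (hy : ∀ c : κ → K, (∀ k, v (algebraMap K L (c k)) ≤ 1) → v (∑ k, c k • y k) < 1 →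
      ∀ k, v (algebraMap K L (c k)) < 1)
    (c : J × κ → K) (s : J × κ) :
    v (c s • (x s.1 * y s.2)) ≤ v (∑ s, c s • (x s.1 * y s.2)) := by
  have key : ∀ d : κ → K, ∃ k, ∀ l, v (algebraMap K L (d l)) ≤ v (algebraMap K L (d k)) ∧
      v (∑ k, d k • y k) = v (algebraMap K L (d k)) := by
    intro d
    obtain ⟨k, -, hk⟩ := Finset.exists_max_image Finset.univ
      (fun j => v (algebraMap K L (d j))) ⟨s.2, Finset.mem_univ _⟩
    refine ⟨k, fun l => ⟨hk l (Finset.mem_univ l), ?_⟩⟩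
    have hle : v (∑ k, d k • y k) ≤ v (algebraMap K L (d k)) := by
      refine v.map_sum_le fun l _ => ?_
      rw [Algebra.smul_def, map_mul]
      exact (mul_le_of_le_one_right zero_le (hyle l)).trans (hk l (Finset.mem_univ l))
    rcases eq_or_ne (d k) 0 with h0 | h0
    · refine le_antisymm hle ?_
      rw [h0]; simp
    have hv0 : 0 < v (algebraMap K L (d k)) := zero_lt_iff.mpr (by simpa using h0)
    refine le_antisymm hle (le_of_not_gt fun hlt => ?_)
    have := hy (fun l => d l / d k) (fun l => by
      rw [map_div₀, map_div₀, div_le_one₀ hv0]; exact hk l (Finset.mem_univ l)) (by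
      have : ∑ l, (d l / d k) • y l = (algebraMap K L (d k))⁻¹ * ∑ l, d l • y l := by
        rw [Finset.mul_sum]
        refine Finset.sum_congr rfl fun l _ => ?_
        rw [Algebra.smul_def, Algebra.smul_def, map_div₀]
        ring
      rw [this, map_mul, map_inv₀, inv_mul_lt_iff₀ hv0, mul_one]
      exact hlt) k
    simp [h0] at this
  let T : J → L := fun j => ∑ k, c (j, k) • y k
  have hT : ∑ s, c s • (x s.1 * y s.2) = ∑ j, T j * x j := by
    rw [Fintype.sum_prod_type]
    refine Finset.sum_congr rfl fun j _ => ?_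
    rw [Finset.sum_mul]
    refine Finset.sum_congr rfl fun k _ => ?_
    rw [Algebra.smul_def, Algebra.smul_def]
    ring
  rw [hT]
  refine le_trans ?_ (v.map_le_map_sum_of_injective (fun j => T j * x j) ?_ s.1)
  · obtain ⟨k, hk⟩ := key fun k => c (s.1, k)
    rw [Algebra.smul_def, map_mul, map_mul, map_mul, (hk k).2]
    rw [mul_left_comm, ← mul_assoc, mul_comm (v (x s.1))]
    calc _ ≤ v (algebraMap K L (c s)) * v (x s.1) := mul_le_of_le_one_right zero_le (hyle _)
      _ ≤ _ := by gcongr; exact (hk s.2).1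
  · intro i j hij hi
    obtain ⟨k, hk⟩ := key fun k => c (i, k)
    obtain ⟨k', hk'⟩ := key fun k => c (j, k)
    simp only [map_mul] at hij hi
    rw [(hk k).2] at hij hi
    rw [(hk' k').2] at hij
    refine hx i j (c (j, k') / c (i, k)) ?_
    rw [Algebra.smul_def, map_mul, map_div₀, map_div₀, div_mul_eq_mul_div,
      eq_div_iff (left_ne_zero_of_mul hi), mul_comm, hij]

theorem Valuation.linearIndependent_of_approx {Γ₀ : Type*} [LinearOrderedCommGroupWithZero Γ₀]
    [Algebra K L] {ι : Type*} [Fintype ι] (V : ι → Valuation L Γ₀)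
    (hf : ∀ i j c, V i (algebraMap K L c) = V j (algebraMap K L c)) {σ : ι → Type*}
    [∀ i, Fintype (σ i)] (u z : (Σ i, σ i) → L)
    (hmax : ∀ i (c : σ i → K) s, V i (c s • u ⟨i, s⟩) ≤ V i (∑ s, c s • u ⟨i, s⟩))
    (hz : ∀ s, V s.1 (z s - u s) < V s.1 (u s))
    (hz' : ∀ s l, l ≠ s.1 → V l (z s) < V s.1 (u s)) :
    LinearIndependent K z := by
  classical
  rw [Fintype.linearIndependent_iff]
  intro c hc
  by_contra! hne
  obtain ⟨s₀, hs₀⟩ := hne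
  obtain ⟨t, -, ht⟩ := Finset.exists_max_image Finset.univ
    (fun s : Σ i, σ i => V s.1 (c s • u s)) ⟨s₀, Finset.mem_univ _⟩
  have hmul : ∀ i d y, V i (d • y) = V i (algebraMap K L d) * V i y := fun i d y => by
    rw [Algebra.smul_def, map_mul]
  have hupos : ∀ s, 0 < V s.1 (u s) := fun s => lt_of_le_of_lt zero_le (hz s)
  have hpos : 0 < V t.1 (c t • u t) := by
    refine lt_of_lt_of_le ?_ (ht s₀ (Finset.mem_univ _))
    rw [hmul]
    exact mul_pos (zero_lt_iff.mpr (by simpa using hs₀)) (hupos s₀)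
  have hlt : ∀ s a, a < V s.1 (u s) →
      V t.1 (algebraMap K L (c s)) * a < V t.1 (c t • u t) := fun s a ha => by
    rcases eq_or_ne (c s) 0 with h0 | h0
    · rw [h0]; simpa using hpos
    · refine lt_of_lt_of_le ?_ (ht s (Finset.mem_univ _))
      rw [hmul, hf t.1 s.1]
      exact mul_lt_mul_of_pos_left ha (zero_lt_iff.mpr (by simpa using h0))
  have h1 : V t.1 (∑ s, c ⟨t.1, s⟩ • z ⟨t.1, s⟩ - ∑ s, c ⟨t.1, s⟩ • u ⟨t.1, s⟩) <
      V t.1 (c t • u t) := by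
    rw [← Finset.sum_sub_distrib]
    refine (V t.1).map_sum_lt' hpos fun s _ => ?_
    rw [← smul_sub, hmul]
    exact hlt ⟨t.1, s⟩ _ (hz ⟨t.1, s⟩)
  have h2 : V t.1 (∑ i ∈ Finset.univ.erase t.1, ∑ s, c ⟨i, s⟩ • z ⟨i, s⟩) <
      V t.1 (c t • u t) := by
    refine (V t.1).map_sum_lt' hpos fun i hi => (V t.1).map_sum_lt' hpos fun s _ => ?_
    rw [hmul]
    exact hlt ⟨i, s⟩ _ (hz' ⟨i, s⟩ t.1 (Finset.ne_of_mem_erase hi).symm)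
  have h3 := hmax t.1 (fun s => c ⟨t.1, s⟩) t.2
  have h4 : ∑ s, c ⟨t.1, s⟩ • u ⟨t.1, s⟩ =
      - ((∑ s, c ⟨t.1, s⟩ • z ⟨t.1, s⟩ - ∑ s, c ⟨t.1, s⟩ • u ⟨t.1, s⟩) +
        ∑ i ∈ Finset.univ.erase t.1, ∑ s, c ⟨i, s⟩ • z ⟨i, s⟩) := by
    rw [Fintype.sum_sigma, ← Finset.add_sum_erase _ _ (Finset.mem_univ t.1)] at hc
    rw [eq_neg_iff_add_eq_zero, ← hc]
    abel
  rw [h4, Valuation.map_neg] at h3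
  exact absurd ((V t.1).map_add_lt h1 h2) (not_lt.mpr h3)

theorem ValuationSubring.sum_card_mul_card_le_finrank [Algebra K L] [FiniteDimensional K L]
    {Ov : ValuationSubring K} {ι : Type*} [Fintype ι] (Ow : ι → ValuationSubring L)
    (hinj : Function.Injective Ow) (hcomap : ∀ i, (Ow i).comap (algebraMap K L) = Ov)
    {J κ : ι → Type*} [∀ i, Fintype (J i)] [∀ i, Fintype (κ i)]
    (x : ∀ i, J i → L) (y : ∀ i, κ i → L) (hx0 : ∀ i j, x i j ≠ 0)
    (hx : ∀ i j j' (c : K), (Ow i).valuation (x i j) = (Ow i).valuation (c • x i j') → j = j')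
    (hymem : ∀ i k, y i k ∈ Ow i)
    (hy : ∀ i (c : κ i → K), (∀ k, c k ∈ Ov) → (Ow i).valuation (∑ k, c k • y i k) < 1 →
      ∀ k, Ov.valuation (c k) < 1) :
    ∑ i, Fintype.card (J i) * Fintype.card (κ i) ≤ Module.finrank K L := by
  choose V hV hVK using fun i => exists_valuation_of_comap_eq (hcomap i)
  have hVlt : ∀ i a b, V i a < V i b ↔ (Ow i).valuation a < (Ow i).valuation b :=
    fun i a b => by rw [← not_le, ← not_le, hV]
  have hVle1 : ∀ i a, V i a ≤ 1 ↔ a ∈ Ow i := fun i a => by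
    rw [← (V i).map_one, hV, map_one, valuation_le_one_iff]
  have hVlt1 : ∀ i a, V i a < 1 ↔ (Ow i).valuation a < 1 := fun i a => by
    rw [← (V i).map_one, hVlt, map_one]
  have hVK1 : ∀ i (c : K), V i (algebraMap K L c) < 1 ↔ Ov.valuation c < 1 := fun i c => by
    rw [hVlt1, ← Ov.valuation.map_one, ← valuation_lt_iff_of_comap_eq (hcomap i), map_one, map_one]
  have hf : ∀ i j c, V i (algebraMap K L c) = V j (algebraMap K L c) := fun i j c => by
    rw [hVK, hVK]
  have htors : ∀ i x, ∃ N > 0, ∃ c, V i (x ^ N) = V i (algebraMap K L c) := fun i x => by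
    obtain ⟨c, hc⟩ := (V i).exists_map_pow_factorial_eq (K := K) x
    exact ⟨_, Nat.factorial_pos _, c, hc⟩
  have hnle : ∀ i j, i ≠ j → ∃ u ∈ Ow i, u ∉ Ow j := fun i j hij => by
    by_contra! h
    exact hij (hinj (eq_of_le_of_comap_eq (K := K) (fun u => h u)
      ((hcomap i).trans (hcomap j).symm)))
  have hinc : ∀ i j, i ≠ j → ∃ b, 1 < V i b ∧ V j b < 1 := by
    intro i j hij
    obtain ⟨a, hai, haj⟩ := hnle i j hij
    obtain ⟨b, hbj, hbi⟩ := hnle j i hij.symm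
    rw [← hVle1] at hai hbj
    rw [← hVle1, not_le] at haj hbi
    have ha0 : a ≠ 0 := by rintro rfl; simp at haj
    refine ⟨b / a, ?_, ?_⟩
    · rw [map_div₀, one_lt_div₀ (zero_lt_iff.mpr ((V i).ne_zero_iff.mpr ha0))]
      exact hai.trans_lt hbi
    · rw [map_div₀, div_lt_one₀ (zero_lt_one.trans haj)]
      exact hbj.trans_lt haj
  let u : (Σ i, J i × κ i) → L := fun s => x s.1 s.2.1 * y s.1 s.2.2
  have hy0 : ∀ i k, y i k ≠ 0 := by
    classical
    intro i k h
    have := hy i (fun l => if l = k then 1 else 0) (fun l => by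
      split_ifs
      · exact one_mem _
      · exact zero_mem _) (by simp [h]) k
    simp at this
  have hu : ∀ s, u s ≠ 0 := fun s => mul_ne_zero (hx0 _ _) (hy0 _ _)
  choose z hz hz' using fun s : Σ i, J i × κ i =>
    Valuation.exists_sub_lt_and_forall_lt V (algebraMap K L) hf htors hinc s.1 (hu s)
  have hlin := Valuation.linearIndependent_of_approx V hf u z (fun i c s => by
    refine Valuation.map_smul_mul_le_map_sum (V i) (x i) (y i) ?_ ?_ ?_ c s
    · intro j j' d h
      refine hx i j j' d (le_antisymm ?_ ?_)
      · rw [← hV]; exact h.le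
      · rw [← hV]; exact h.ge
    · exact fun k => (hVle1 i _).mpr (hymem i k)
    · intro d hd hd' k
      rw [hVK1]
      refine hy i d (fun k => ?_) ((hVlt1 _ _).mp hd') k
      rw [← hcomap i, mem_comap, ← hVle1]
      exact hd k) hz hz'
  have := hlin.fintype_card_le_finrank
  simpa [Fintype.card_sigma] using this

theorem ramificationIndex_eq_index (f : K →+* L) (Ow : ValuationSubring L) :
    ramificationIndex f Ow = ((Units.map (f : K →* L)).range ⊔ Ow.unitGroup).index := by
  rw [ramificationIndex, MonoidHom.range_comp, Subgroup.index_map, QuotientGroup.ker_mk',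
    QuotientGroup.range_mk', Subgroup.index_top, mul_one]

theorem mem_range_sup_unitGroup_iff (f : K →+* L) (Ow : ValuationSubring L) (x : Lˣ) :
    x ∈ (Units.map (f : K →* L)).range ⊔ Ow.unitGroup ↔
      ∃ c : K, Ow.valuation x = Ow.valuation (f c) := by
  rw [Subgroup.mem_sup]
  constructor
  · rintro ⟨_, ⟨c, rfl⟩, u, hu, rfl⟩
    refine ⟨c, ?_⟩
    rw [ValuationSubring.mem_unitGroup_iff] at hu
    simp [hu]
  · rintro ⟨c, hc⟩
    have hx : Ow.valuation x ≠ 0 := Ow.valuation.ne_zero_iff.mpr x.ne_zero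
    have hc0 : c ≠ 0 := by rintro rfl; simp at hc
    refine ⟨Units.map (f : K →* L) (Units.mk0 c hc0), ⟨_, rfl⟩,
      (Units.map (f : K →* L) (Units.mk0 c hc0))⁻¹ * x, ?_, by simp⟩
    rw [ValuationSubring.mem_unitGroup_iff]
    have : Ow.valuation (f c) ≠ 0 := hc ▸ hx
    simp [hc, this]

theorem inertiaDegree_eq_finrank (f : K →+* L) (Ov : ValuationSubring K)
    (Ow : ValuationSubring L) (h : Ow.comap f = Ov) :
    inertiaDegree f Ov Ow = @Module.finrank (IsLocalRing.ResidueField Ov)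
      (IsLocalRing.ResidueField Ow) _ _ (residueFieldMap f Ov Ow h).toAlgebra.toModule :=
  dif_pos h

theorem ValuationSubring.residue_eq_zero_iff (A : ValuationSubring K) (x : A) :
    IsLocalRing.residue A x = 0 ↔ A.valuation x < 1 := by
  rw [IsLocalRing.residue_eq_zero_iff, valuation_lt_one_iff]

theorem residueFieldMap_residue (f : K →+* L) (Ov : ValuationSubring K)
    (Ow : ValuationSubring L) (h : Ow.comap f = Ov) (x : Ov) :
    residueFieldMap f Ov Ow h (IsLocalRing.residue Ov x) =
      IsLocalRing.residue Ow (prolongHom f Ov Ow h x) := rfl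

section FundamentalInequality

variable [Algebra K L] [FiniteDimensional K L]

theorem sum_card_mul_card_le_finrank_of_linearIndependent
    {Ov : ValuationSubring K} {ι : Type*} [Fintype ι] (Ow : ι → ValuationSubring L)
    (hinj : Function.Injective Ow) (hcomap : ∀ i, (Ow i).comap (algebraMap K L) = Ov)
    {J κ : ι → Type*} [∀ i, Fintype (J i)] [∀ i, Fintype (κ i)]
    (x : ∀ i, J i →
      Lˣ ⧸ ((Units.map (algebraMap K L : K →* L)).range ⊔ (Ow i).unitGroup))
    (hx : ∀ i, Function.Injective (x i))
    (y : ∀ i, κ i → IsLocalRing.ResidueField (Ow i))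
    (hy : ∀ i, @LinearIndependent (κ i) (IsLocalRing.ResidueField Ov) _ (y i) _ _
      (residueFieldMap (algebraMap K L) Ov (Ow i) (hcomap i)).toAlgebra.toModule) :
    ∑ i, Fintype.card (J i) * Fintype.card (κ i) ≤ Module.finrank K L := by
  choose x' hx' using fun i j => QuotientGroup.mk_surjective (x i j)
  choose y' hy' using fun i k => IsLocalRing.residue_surjective (y i k)
  refine ValuationSubring.sum_card_mul_card_le_finrank Ow hinj hcomap (fun i j => (x' i j : L))
    (fun i k => (y' i k : L)) (fun i j => (x' i j).ne_zero) ?_ (fun i k => (y' i k).2) ?_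
  · intro i j j' c h
    refine hx i ?_
    rw [← hx', ← hx', eq_comm, QuotientGroup.eq, mem_range_sup_unitGroup_iff]
    refine ⟨c, ?_⟩
    have h0 : (Ow i).valuation (x' i j') ≠ 0 :=
      (Ow i).valuation.ne_zero_iff.mpr (x' i j').ne_zero
    rw [Units.val_mul, map_mul, h, Algebra.smul_def, map_mul, Units.val_inv_eq_inv_val, map_inv₀,
      mul_comm, mul_assoc, mul_inv_cancel₀ h0, mul_one]
  · intro i c hc hlt k
    let := (residueFieldMap (algebraMap K L) Ov (Ow i) (hcomap i)).toAlgebra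
    have hli := Fintype.linearIndependent_iff.mp (hy i)
      (fun k => IsLocalRing.residue Ov ⟨c k, hc k⟩) (by
        have : ∑ k, IsLocalRing.residue Ov ⟨c k, hc k⟩ • y i k = IsLocalRing.residue (Ow i)
            (∑ k, prolongHom (algebraMap K L) Ov (Ow i) (hcomap i) ⟨c k, hc k⟩ * y' i k) := by
          rw [map_sum]
          refine Finset.sum_congr rfl fun k _ => ?_
          rw [map_mul, hy', ← residueFieldMap_residue, Algebra.smul_def]
          rfl
        rw [this, ValuationSubring.residue_eq_zero_iff]
        convert hlt using 2
        rw [AddSubmonoidClass.coe_finsetSum]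
        refine Finset.sum_congr rfl fun k _ => ?_
        rw [Algebra.smul_def]
        rfl) k
    exact (ValuationSubring.residue_eq_zero_iff _ _).mp hli

theorem finite_quotient_range_sup_unitGroup {Ov : ValuationSubring K} {Ow : ValuationSubring L}
    (h : Ow.comap (algebraMap K L) = Ov) :
    Finite (Lˣ ⧸ ((Units.map (algebraMap K L : K →* L)).range ⊔ Ow.unitGroup)) := by
  by_contra hinf
  rw [not_finite_iff_infinite] at hinf
  obtain ⟨s, hs⟩ := Infinite.exists_subset_card_eq
    (Lˣ ⧸ ((Units.map (algebraMap K L : K →* L)).range ⊔ Ow.unitGroup)) (Module.finrank K L + 1)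
  let := (residueFieldMap (algebraMap K L) Ov Ow h).toAlgebra
  have := sum_card_mul_card_le_finrank_of_linearIndependent (ι := Unit) (J := fun _ => s)
    (κ := fun _ => Unit) (fun _ => Ow)
    (fun _ _ _ => rfl) (fun _ => h) (fun _ j => (j : Lˣ ⧸ _)) (fun _ => Subtype.val_injective)
    (fun _ _ => 1) (fun _ => LinearIndependent.of_subsingleton () one_ne_zero)
  simp [hs] at this

theorem residueFieldMap_finite {Ov : ValuationSubring K} {Ow : ValuationSubring L}
    (h : Ow.comap (algebraMap K L) = Ov) :
    @Module.Finite (IsLocalRing.ResidueField Ov) (IsLocalRing.ResidueField Ow) _ _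
      (residueFieldMap (algebraMap K L) Ov Ow h).toAlgebra.toModule := by
  let := (residueFieldMap (algebraMap K L) Ov Ow h).toAlgebra
  rw [← Module.rank_lt_aleph0_iff]
  refine lt_of_le_of_lt (rank_le (n := Module.finrank K L) fun s hs => ?_)
    Cardinal.natCast_lt_aleph0
  have := sum_card_mul_card_le_finrank_of_linearIndependent (ι := Unit) (J := fun _ => Unit)
    (κ := fun _ => s) (fun _ => Ow)
    (fun _ _ _ => rfl) (fun _ => h) (fun _ _ => 1) (fun _ _ _ _ => rfl)
    (fun _ k => (k : IsLocalRing.ResidueField Ow)) (fun _ => hs)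
  simpa using this

theorem ramificationIndex_pos {Ov : ValuationSubring K} {Ow : ValuationSubring L}
    (h : Ow.comap (algebraMap K L) = Ov) : 0 < ramificationIndex (algebraMap K L) Ow := by
  have := finite_quotient_range_sup_unitGroup h
  rw [ramificationIndex_eq_index]
  exact Nat.card_pos

theorem inertiaDegree_pos {Ov : ValuationSubring K} {Ow : ValuationSubring L}
    (h : Ow.comap (algebraMap K L) = Ov) : 0 < inertiaDegree (algebraMap K L) Ov Ow := by
  rw [inertiaDegree_eq_finrank _ _ _ h]
  let := (residueFieldMap (algebraMap K L) Ov Ow h).toAlgebra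
  have : Module.Finite (IsLocalRing.ResidueField Ov) (IsLocalRing.ResidueField Ow) :=
    residueFieldMap_finite h
  exact Module.finrank_pos

theorem exists_linearIndependent_inertiaDegree {Ov : ValuationSubring K}
    {Ow : ValuationSubring L} (h : Ow.comap (algebraMap K L) = Ov) :
    ∃ y : Fin (inertiaDegree (algebraMap K L) Ov Ow) → IsLocalRing.ResidueField Ow,
      @LinearIndependent _ (IsLocalRing.ResidueField Ov) _ y _ _
        (residueFieldMap (algebraMap K L) Ov Ow h).toAlgebra.toModule := by
  rw [inertiaDegree_eq_finrank _ _ _ h]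
  let := (residueFieldMap (algebraMap K L) Ov Ow h).toAlgebra
  have : Module.Finite (IsLocalRing.ResidueField Ov) (IsLocalRing.ResidueField Ow) :=
    residueFieldMap_finite h
  exact ⟨_, (Module.finBasis _ _).linearIndependent⟩

theorem sum_ramificationIndex_mul_inertiaDegree_le (Ov : ValuationSubring K)
    (S : Finset (ValuationSubring L)) (hS : ∀ Ow ∈ S, Ow.comap (algebraMap K L) = Ov) :
    ∑ Ow ∈ S, ramificationIndex (algebraMap K L) Ow * inertiaDegree (algebraMap K L) Ov Ow ≤
      Module.finrank K L := by
  have hfin : ∀ i : S, Finite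
      (Lˣ ⧸ ((Units.map (algebraMap K L : K →* L)).range ⊔ (i : ValuationSubring L).unitGroup)) :=
    fun i => finite_quotient_range_sup_unitGroup (hS i i.2)
  have := fun i : S => Fintype.ofFinite
    (Lˣ ⧸ ((Units.map (algebraMap K L : K →* L)).range ⊔ (i : ValuationSubring L).unitGroup))
  choose y hy using fun i : S => exists_linearIndependent_inertiaDegree (hS i i.2)
  have key := sum_card_mul_card_le_finrank_of_linearIndependent (ι := S)
    (fun i => (i : ValuationSubring L)) Subtype.val_injective (fun i => hS i i.2)
    (J := fun i : S => Lˣ ⧸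
      ((Units.map (algebraMap K L : K →* L)).range ⊔ (i : ValuationSubring L).unitGroup))
    (κ := fun i : S => Fin (inertiaDegree (algebraMap K L) Ov i))
    (fun _ => id) (fun _ => Function.injective_id) y hy
  simp only [← Nat.card_eq_fintype_card, Nat.card_fin] at key
  rw [← Finset.sum_coe_sort]
  refine le_trans (Finset.sum_le_sum fun i _ => ?_) key
  rw [ramificationIndex_eq_index, Subgroup.index]

theorem prolongations_finite (Ov : ValuationSubring K) : (prolongations Ov L).Finite := by
  by_contra hinf
  obtain ⟨S, hS, hcard⟩ := Set.Infinite.exists_subset_card_eq hinf (Module.finrank K L + 1)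
  have hS' : ∀ Ow ∈ S, Ow.comap (algebraMap K L) = Ov := fun Ow h => hS h
  have h1 := sum_ramificationIndex_mul_inertiaDegree_le Ov S hS'
  have h2 : S.card ≤ ∑ Ow ∈ S, ramificationIndex (algebraMap K L) Ow *
      inertiaDegree (algebraMap K L) Ov Ow := by
    rw [Finset.card_eq_sum_ones]
    exact Finset.sum_le_sum fun Ow h => Nat.mul_pos (ramificationIndex_pos (hS' _ h))
      (inertiaDegree_pos (hS' _ h))
  omega

/-- The fundamental inequality. -/
theorem finsum_ramificationIndex_mul_inertiaDegree_le (Ov : ValuationSubring K) :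
    ∑ᶠ Ow ∈ prolongations Ov L,
        ramificationIndex (algebraMap K L) Ow * inertiaDegree (algebraMap K L) Ov Ow ≤
      Module.finrank K L := by
  rw [finsum_mem_eq_finite_toFinset_sum _ (prolongations_finite Ov)]
  exact sum_ramificationIndex_mul_inertiaDegree_le Ov _ fun Ow h => by
    simpa [prolongations] using h

theorem fundamentalEquality_iff (Ov : ValuationSubring K) :
    FundamentalEquality Ov L ↔ Module.finrank K L ≤ ∑ᶠ Ow ∈ prolongations Ov L,
        ramificationIndex (algebraMap K L) Ow * inertiaDegree (algebraMap K L) Ov Ow :=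
  ⟨fun h => h.2.le, fun h => ⟨prolongations_finite Ov,
    h.antisymm (finsum_ramificationIndex_mul_inertiaDegree_le Ov)⟩⟩

end FundamentalInequality

/-- The composition of a valuation subring with a valuation subring of its residue field. -/
def ValuationSubring.comp (A : ValuationSubring K)
    (B : ValuationSubring (IsLocalRing.ResidueField A)) : ValuationSubring K :=
  ofSubring ((B.toSubring.comap (IsLocalRing.residue A)).map A.subtype) fun x => by
    have key : ∀ x : K, ∀ h : x ∈ A, IsLocalRing.residue A ⟨x, h⟩ ∈ B →
        x ∈ (B.toSubring.comap (IsLocalRing.residue A)).map A.subtype :=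
      fun x h hx => ⟨⟨x, h⟩, hx, rfl⟩
    have key' : ∀ x : K, ∀ h : x ∈ A, ∀ h' : x⁻¹ ∈ A,
        x ∈ (B.toSubring.comap (IsLocalRing.residue A)).map A.subtype ∨
        x⁻¹ ∈ (B.toSubring.comap (IsLocalRing.residue A)).map A.subtype := by
      intro x h h'
      rcases eq_or_ne x 0 with rfl | hx0
      · exact Or.inl ⟨0, by simp, rfl⟩
      refine (B.mem_or_inv_mem (IsLocalRing.residue A ⟨x, h⟩)).imp (key x h) fun hx => ?_
      refine key _ h' ?_
      convert hx
      refine eq_inv_of_mul_eq_one_left ?_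
      rw [← map_mul, ← map_one (IsLocalRing.residue A)]
      congr 1
      ext
      exact inv_mul_cancel₀ hx0
    have hnonunit : ∀ x : K, x ∈ A → x⁻¹ ∉ A →
        x ∈ (B.toSubring.comap (IsLocalRing.residue A)).map A.subtype := fun x h h' => by
      refine key x h ?_
      have : IsLocalRing.residue A ⟨x, h⟩ = 0 := by
        rw [residue_eq_zero_iff, ← mem_nonunits_iff, mem_nonunits_iff_or]
        exact Or.inr h'
      rw [this]
      exact zero_mem _
    by_cases h : x ∈ A
    · by_cases h' : x⁻¹ ∈ A
      · exact key' x h h'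
      · exact Or.inl (hnonunit x h h')
    · have h' : x⁻¹ ∈ A := (A.mem_or_inv_mem x).resolve_left h
      exact Or.inr (hnonunit x⁻¹ h' (by rwa [inv_inv]))

namespace ValuationSubring

theorem mem_comp {A : ValuationSubring K} {B : ValuationSubring (IsLocalRing.ResidueField A)}
    {x : K} : x ∈ A.comp B ↔ ∃ h : x ∈ A, IsLocalRing.residue A ⟨x, h⟩ ∈ B := by
  refine (mem_ofSubring _ _ _).trans ⟨?_, fun ⟨h, hx⟩ => ⟨⟨x, h⟩, hx, rfl⟩⟩
  rintro ⟨y, hy, rfl⟩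
  exact ⟨y.2, hy⟩

theorem coe_mem_comp {A : ValuationSubring K} {B : ValuationSubring (IsLocalRing.ResidueField A)}
    {x : A} : (x : K) ∈ A.comp B ↔ IsLocalRing.residue A x ∈ B := by
  rw [mem_comp]
  exact ⟨fun ⟨_, h⟩ => h, fun h => ⟨x.2, h⟩⟩

theorem comp_le (A : ValuationSubring K) (B : ValuationSubring (IsLocalRing.ResidueField A)) :
    A.comp B ≤ A := fun _ hx => (mem_comp.mp hx).1

theorem comp_injective (A : ValuationSubring K) : Function.Injective A.comp := by
  intro B C h
  ext x
  obtain ⟨x, rfl⟩ := IsLocalRing.residue_surjective x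
  rw [← coe_mem_comp, h, coe_mem_comp]

theorem exists_comp_eq_of_le {A B : ValuationSubring K} (h : A ≤ B) :
    ∃ C, B.comp C = A := by
  let R := (A.toSubring.comap B.subtype).map (IsLocalRing.residue B)
  have hR : ∀ x : B, IsLocalRing.residue B x ∈ R ↔ (x : K) ∈ A := by
    refine fun x => ⟨?_, fun hx => ⟨x, hx, rfl⟩⟩
    rintro ⟨y, hy, hxy⟩
    have h1 : IsLocalRing.residue B (x - y) = 0 := by rw [map_sub, hxy, sub_self]
    rw [residue_eq_zero_iff, ← mem_nonunits_iff] at h1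
    have h2 : ((x - y : B) : K) ∈ A := A.nonunits_subset (nonunits_le_nonunits.mpr h h1)
    have : (x : K) = ((x - y : B) : K) + y := by push_cast; ring
    rw [this]
    exact A.add_mem _ _ h2 hy
  refine ⟨ofSubring R fun x => ?_, ?_⟩
  · obtain ⟨x, rfl⟩ := IsLocalRing.residue_surjective x
    by_cases hx : (x : K) ∈ A
    · exact Or.inl ((hR x).mpr hx)
    · have hx' := (A.mem_or_inv_mem (x : K)).resolve_left hx
      have hx0 : (x : K) ≠ 0 := fun h0 => hx (h0 ▸ A.zero_mem)
      refine Or.inr ?_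
      convert (hR ⟨(x : K)⁻¹, h hx'⟩).mpr hx'
      refine inv_eq_of_mul_eq_one_right ?_
      rw [← map_mul, ← map_one (IsLocalRing.residue B)]
      congr 1
      ext
      exact mul_inv_cancel₀ hx0
  · ext x
    rw [mem_comp]
    simp only [mem_ofSubring, hR]
    exact ⟨fun ⟨_, hx⟩ => hx, fun hx => ⟨h hx, hx⟩⟩

theorem comap_comp (f : K →+* L) {A : ValuationSubring K} {A' : ValuationSubring L}
    (h : A'.comap f = A) (B' : ValuationSubring (IsLocalRing.ResidueField A')) :
    (A'.comp B').comap f = A.comp (B'.comap (residueFieldMap f A A' h)) := by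
  ext x
  rw [mem_comap]
  by_cases hx : x ∈ A
  · lift x to A using hx
    rw [coe_mem_comp, mem_comap, residueFieldMap_residue, ← coe_mem_comp]
    rfl
  · refine iff_of_false (fun h' => hx ?_) fun h' => hx (comp_le _ _ h')
    rw [← h, mem_comap]
    exact comp_le _ _ h'

theorem valuation_comp_le_iff {A : ValuationSubring K}
    {B : ValuationSubring (IsLocalRing.ResidueField A)} {a b : A} (hb : IsUnit b) :
    (A.comp B).valuation a ≤ (A.comp B).valuation b ↔
      B.valuation (IsLocalRing.residue A a) ≤ B.valuation (IsLocalRing.residue A b) := by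
  obtain ⟨b, rfl⟩ := hb
  have hb0 : ((b : A) : K) ≠ 0 := by simp
  have hb1 : IsLocalRing.residue A b ≠ 0 := (IsLocalRing.residue_ne_zero_iff_isUnit _).mpr b.isUnit
  have hb2 : 0 < (A.comp B).valuation (b : A) :=
    zero_lt_iff.mpr ((A.comp B).valuation.ne_zero_iff.mpr hb0)
  have hb3 : 0 < B.valuation (IsLocalRing.residue A b) :=
    zero_lt_iff.mpr (B.valuation.ne_zero_iff.mpr hb1)
  rw [← div_le_one₀ hb2, ← div_le_one₀ hb3, ← map_div₀, ← map_div₀,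
    valuation_le_one_iff, valuation_le_one_iff]
  have h1 : (a : K) / (b : A) = (a * (b⁻¹ : Aˣ) : A) := by
    rw [div_eq_iff hb0, ← MulMemClass.coe_mul, mul_assoc, Units.inv_mul, mul_one]
  have h2 : IsLocalRing.residue A a / IsLocalRing.residue A b =
      IsLocalRing.residue A (a * (b⁻¹ : Aˣ) : A) := by
    rw [div_eq_iff hb1, ← map_mul, mul_assoc, Units.inv_mul, mul_one]
  rw [h1, h2, coe_mem_comp]

theorem valuation_comp_eq_iff {A : ValuationSubring K}
    {B : ValuationSubring (IsLocalRing.ResidueField A)} {a b : A} (ha : IsUnit a)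
    (hb : IsUnit b) : (A.comp B).valuation a = (A.comp B).valuation b ↔
      B.valuation (IsLocalRing.residue A a) = B.valuation (IsLocalRing.residue A b) := by
  rw [le_antisymm_iff, le_antisymm_iff, valuation_comp_le_iff hb, valuation_comp_le_iff ha]

/-- The reduction map from a composition of valuation subrings. -/
noncomputable def compReduction (A : ValuationSubring K)
    (B : ValuationSubring (IsLocalRing.ResidueField A)) : A.comp B →+* B :=
  ((IsLocalRing.residue A).comp (inclusion _ _ (A.comp_le B))).codRestrict B.toSubring
    fun x => (coe_mem_comp (x := inclusion _ _ (A.comp_le B) x)).mp x.2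

theorem compReduction_surjective (A : ValuationSubring K)
    (B : ValuationSubring (IsLocalRing.ResidueField A)) :
    Function.Surjective (A.compReduction B) := by
  rintro ⟨y, hy⟩
  obtain ⟨x, rfl⟩ := IsLocalRing.residue_surjective y
  exact ⟨⟨x, coe_mem_comp.mpr hy⟩, rfl⟩

/-- The residue field of a composition of valuation subrings. -/
noncomputable def residueFieldCompEquiv (A : ValuationSubring K)
    (B : ValuationSubring (IsLocalRing.ResidueField A)) :
    IsLocalRing.ResidueField (A.comp B) ≃+* IsLocalRing.ResidueField B :=
  haveI : IsLocalHom (A.compReduction B) := (A.compReduction_surjective B).isLocalHom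
  RingEquiv.ofBijective (IsLocalRing.ResidueField.map (A.compReduction B))
    ⟨RingHom.injective _, fun y => by
      obtain ⟨b, rfl⟩ := IsLocalRing.residue_surjective y
      obtain ⟨a, rfl⟩ := A.compReduction_surjective B b
      exact ⟨IsLocalRing.residue _ a, rfl⟩⟩

end ValuationSubring

theorem inertiaDegree_comp (f : K →+* L) {A : ValuationSubring K} {A' : ValuationSubring L}
    (h : A'.comap f = A) {B : ValuationSubring (IsLocalRing.ResidueField A)}
    {B' : ValuationSubring (IsLocalRing.ResidueField A')}
    (hB : B'.comap (residueFieldMap f A A' h) = B) :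
    inertiaDegree f (A.comp B) (A'.comp B') =
      inertiaDegree (residueFieldMap f A A' h) B B' := by
  have hc : (A'.comp B').comap f = A.comp B := by rw [ValuationSubring.comap_comp f h, hB]
  rw [inertiaDegree_eq_finrank f _ _ hc, inertiaDegree_eq_finrank _ _ _ hB]
  let := (residueFieldMap f (A.comp B) (A'.comp B') hc).toAlgebra
  let := (residueFieldMap (residueFieldMap f A A' h) B B' hB).toAlgebra
  refine Algebra.finrank_eq_of_equiv_equiv (A.residueFieldCompEquiv B)
    (A'.residueFieldCompEquiv B') ?_
  ext x
  obtain ⟨x, rfl⟩ := IsLocalRing.residue_surjective x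
  rfl

theorem relIndex_range_sup_unitGroup_comp (f : K →+* L) {A : ValuationSubring K}
    {A' : ValuationSubring L} (h : A'.comap f = A)
    (B' : ValuationSubring (IsLocalRing.ResidueField A')) :
    ((Units.map (f : K →* L)).range ⊔ (A'.comp B').unitGroup).relIndex A'.unitGroup =
      ramificationIndex (residueFieldMap f A A' h) B' := by
  rw [ramificationIndex_eq_index, Subgroup.relIndex,
    ← Subgroup.index_comap_of_surjective _ A'.surjective_unitGroupToResidueFieldUnits]
  congr 1
  ext x
  rw [Subgroup.mem_subgroupOf, Subgroup.mem_comap, mem_range_sup_unitGroup_iff,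
    mem_range_sup_unitGroup_iff]
  obtain ⟨x, rfl⟩ := A'.unitGroupMulEquiv.symm.surjective x
  have := prolongHom_isLocalHom f A A' h
  have key : ∀ c : A, IsUnit c → ((A'.comp B').valuation (x : A') = (A'.comp B').valuation (f c) ↔
      B'.valuation (IsLocalRing.residue A' x) =
        B'.valuation (residueFieldMap f A A' h (IsLocalRing.residue A c))) := fun c hc =>
    ValuationSubring.valuation_comp_eq_iff (b := prolongHom f A A' h c) x.isUnit (hc.map _)
  have hx1 : A'.valuation (x : A') = 1 := (A'.valuation_eq_one_iff _).mp x.isUnit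
  change (∃ c, (A'.comp B').valuation (x : A') = _) ↔
    ∃ c, B'.valuation (IsLocalRing.residue A' x) = _
  constructor
  · rintro ⟨c, hc⟩
    have h1 := congrArg ((A'.comp B').mapOfLE A' (A'.comp_le B')) hc
    rw [ValuationSubring.mapOfLE_valuation_apply, ValuationSubring.mapOfLE_valuation_apply, hx1,
      ← map_one A'.valuation, ← map_one f, ValuationSubring.valuation_eq_iff_of_comap_eq h,
      map_one, eq_comm] at h1
    lift c to A using (A.valuation_le_one_iff c).mp h1.le
    exact ⟨_, (key c ((A.valuation_eq_one_iff c).mpr h1)).mp hc⟩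
  · rintro ⟨c, hc⟩
    obtain ⟨c, rfl⟩ := IsLocalRing.residue_surjective c
    refine ⟨c, (key c ?_).mpr hc⟩
    rw [← IsLocalRing.residue_ne_zero_iff_isUnit]
    intro h0
    rw [h0, map_zero, map_zero, map_eq_zero] at hc
    exact (IsLocalRing.residue_ne_zero_iff_isUnit _).mpr x.isUnit hc

theorem ramificationIndex_comp (f : K →+* L) {A : ValuationSubring K}
    {A' : ValuationSubring L} (h : A'.comap f = A)
    (B' : ValuationSubring (IsLocalRing.ResidueField A')) :
    ramificationIndex f (A'.comp B') =
      ramificationIndex (residueFieldMap f A A' h) B' * ramificationIndex f A' := by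
  have hle : (A'.comp B').unitGroup ≤ A'.unitGroup :=
    ValuationSubring.unitGroup_le_unitGroup.mpr (A'.comp_le B')
  rw [← relIndex_range_sup_unitGroup_comp f h, ramificationIndex_eq_index,
    ramificationIndex_eq_index, ← Subgroup.relIndex_mul_index (sup_le_sup_left hle _)]
  congr 1
  rw [← sup_eq_right.mpr hle, ← sup_assoc, sup_eq_right.mpr hle, Subgroup.relIndex_sup_left]

theorem ValuationSubring.exists_le_comap_eq_of_le (f : K →+* L) {A B : ValuationSubring K}
    (hAB : A ≤ B) {A' : ValuationSubring L} (hA : A'.comap f = A) :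
    ∃ B', A' ≤ B' ∧ B'.comap f = B := by
  refine ⟨{
    carrier := {x | ∃ c ∈ B, A'.valuation x ≤ A'.valuation (f c)}
    mul_mem' := ?_
    one_mem' := ⟨1, B.one_mem, by simp⟩
    add_mem' := ?_
    zero_mem' := ⟨0, B.zero_mem, by simp⟩
    neg_mem' := fun ⟨c, hc, h⟩ => ⟨c, hc, by rwa [Valuation.map_neg]⟩
    mem_or_inv_mem' := ?_ }, ?_, ?_⟩
  · rintro x y ⟨c, hc, hx⟩ ⟨d, hd, hy⟩
    exact ⟨c * d, B.mul_mem _ _ hc hd, by simpa only [map_mul] using mul_le_mul' hx hy⟩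
  · rintro x y ⟨c, hc, hx⟩ ⟨d, hd, hy⟩
    exact (le_max_iff.mp (A'.valuation.map_add x y)).elim (fun h => ⟨c, hc, h.trans hx⟩)
      fun h => ⟨d, hd, h.trans hy⟩
  · exact fun x => (A'.mem_or_inv_mem x).imp
      (fun h => ⟨1, B.one_mem, by simpa [valuation_le_one_iff] using h⟩)
      (fun h => ⟨1, B.one_mem, by simpa only [map_one, valuation_le_one_iff] using h⟩)
  · exact fun x h => ⟨1, B.one_mem, by simpa [valuation_le_one_iff] using h⟩
  · ext a
    refine ⟨?_, fun ha => ⟨a, ha, le_rfl⟩⟩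
    rintro ⟨c, hc, h⟩
    rw [valuation_le_iff_of_comap_eq hA] at h
    rcases eq_or_ne c 0 with rfl | hc0
    · rw [map_zero, le_zero_iff, map_eq_zero] at h
      exact h ▸ hc
    · have h1 : a / c ∈ B := hAB <| by
        rw [← valuation_le_one_iff, map_div₀]
        exact div_le_one_of_le₀ h zero_le
      simpa [hc0] using B.mul_mem _ _ h1 hc

section Comp

variable [Algebra K L]

theorem prolongations_comp_eq_iUnion (A : ValuationSubring K)
    (B : ValuationSubring (IsLocalRing.ResidueField A)) :
    prolongations (A.comp B) L = ⋃ A' : prolongations A L,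
      (A' : ValuationSubring L).comp ''
        {B' | B'.comap (residueFieldMap (algebraMap K L) A A' A'.2) = B} := by
  ext C
  simp only [Set.mem_iUnion, Set.mem_image]
  constructor
  · intro hC
    obtain ⟨A', hCA', hA'⟩ := ValuationSubring.exists_le_comap_eq_of_le _ (A.comp_le B) hC
    obtain ⟨B', rfl⟩ := ValuationSubring.exists_comp_eq_of_le hCA'
    exact ⟨⟨A', hA'⟩, B', A.comp_injective ((ValuationSubring.comap_comp _ hA' B').symm.trans hC),
      rfl⟩
  · rintro ⟨⟨A', hA'⟩, B', hB', rfl⟩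
    exact (ValuationSubring.comap_comp _ hA' B').trans (congrArg A.comp hB')

theorem eq_of_comp_eq_comp [FiniteDimensional K L] {A : ValuationSubring K}
    {A₁ A₂ : ValuationSubring L}
    (h₁ : A₁ ∈ prolongations A L) (h₂ : A₂ ∈ prolongations A L)
    {B₁ : ValuationSubring (IsLocalRing.ResidueField A₁)}
    {B₂ : ValuationSubring (IsLocalRing.ResidueField A₂)} (h : A₁.comp B₁ = A₂.comp B₂) :
    A₁ = A₂ := by
  rcases le_total (⟨A₁, A₁.comp_le B₁⟩ : {S // A₁.comp B₁ ≤ S}) ⟨A₂, h ▸ A₂.comp_le B₂⟩ with h | h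
  · exact ValuationSubring.eq_of_le_of_comap_eq h (h₁.trans h₂.symm)
  · exact (ValuationSubring.eq_of_le_of_comap_eq h (h₂.trans h₁.symm)).symm

theorem finsum_prolongations_comp [FiniteDimensional K L] (A : ValuationSubring K)
    (B : ValuationSubring (IsLocalRing.ResidueField A)) :
    ∑ᶠ C ∈ prolongations (A.comp B) L,
        ramificationIndex (algebraMap K L) C * inertiaDegree (algebraMap K L) (A.comp B) C =
      ∑ᶠ A' : prolongations A L, ramificationIndex (algebraMap K L) A' *
        ∑ᶠ B' ∈ {B' | B'.comap (residueFieldMap (algebraMap K L) A A' A'.2) = B},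
          ramificationIndex (residueFieldMap (algebraMap K L) A A' A'.2) B' *
            inertiaDegree (residueFieldMap (algebraMap K L) A A' A'.2) B B' := by
  have hfin : (prolongations (A.comp B) L).Finite := prolongations_finite _
  have : Finite (prolongations A L) := (prolongations_finite A).to_subtype
  rw [prolongations_comp_eq_iUnion] at hfin ⊢
  have hfin' := fun A' : prolongations A L => hfin.subset (Set.subset_iUnion _ A')
  rw [finsum_mem_iUnion _ hfin']
  · refine finsum_congr fun A' => ?_
    rw [finsum_mem_image A'.1.comp_injective.injOn, mul_finsum_mem]
    · refine finsum_mem_congr rfl fun B' hB' => ?_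
      rw [ramificationIndex_comp _ A'.2, inertiaDegree_comp _ A'.2 hB']
      ring
  · rintro ⟨A₁, h₁⟩ ⟨A₂, h₂⟩ hne
    refine Set.disjoint_left.mpr ?_
    rintro _ ⟨B₁, -, rfl⟩ ⟨B₂, -, h⟩
    exact hne (Subtype.ext (eq_of_comp_eq_comp h₁ h₂ h.symm))

end Comp

theorem fundamentalEquality_comp_iff [Algebra K L] [FiniteDimensional K L] (A : ValuationSubring K)
    (B : ValuationSubring (IsLocalRing.ResidueField A)) :
    FundamentalEquality (A.comp B) L ↔ FundamentalEquality A L ∧ ∀ A' : prolongations A L,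
      @FundamentalEquality _ _ B (IsLocalRing.ResidueField A'.1) _
        (residueFieldMap (algebraMap K L) A A' A'.2).toAlgebra := by
  have : Finite (prolongations A L) := (prolongations_finite A).to_subtype
  have := Fintype.ofFinite (prolongations A L)
  have hA := finsum_ramificationIndex_mul_inertiaDegree_le (L := L) A
  rw [fundamentalEquality_iff, fundamentalEquality_iff, finsum_prolongations_comp]
  rw [← finsum_set_coe_eq_finsum_mem (prolongations A L)] at hA ⊢
  rw [finsum_eq_sum_of_fintype] at hA ⊢
  rw [finsum_eq_sum_of_fintype]
  have hle : ∀ A' : prolongations A L,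
      ∑ᶠ B' ∈ {B' | B'.comap (residueFieldMap (algebraMap K L) A A' A'.2) = B},
          ramificationIndex (residueFieldMap (algebraMap K L) A A' A'.2) B' *
            inertiaDegree (residueFieldMap (algebraMap K L) A A' A'.2) B B' ≤
        inertiaDegree (algebraMap K L) A A' := by
    intro A'
    let := (residueFieldMap (algebraMap K L) A A' A'.2).toAlgebra
    have : Module.Finite (IsLocalRing.ResidueField A) (IsLocalRing.ResidueField A'.1) :=
      residueFieldMap_finite A'.2
    rw [inertiaDegree_eq_finrank _ _ _ A'.2]
    exact finsum_ramificationIndex_mul_inertiaDegree_le B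
  have hiff : ∀ A' : prolongations A L,
      @FundamentalEquality _ _ B (IsLocalRing.ResidueField A'.1) _
        (residueFieldMap (algebraMap K L) A A' A'.2).toAlgebra ↔
      inertiaDegree (algebraMap K L) A A' ≤
        ∑ᶠ B' ∈ {B' | B'.comap (residueFieldMap (algebraMap K L) A A' A'.2) = B},
          ramificationIndex (residueFieldMap (algebraMap K L) A A' A'.2) B' *
            inertiaDegree (residueFieldMap (algebraMap K L) A A' A'.2) B B' := by
    intro A'
    let := (residueFieldMap (algebraMap K L) A A' A'.2).toAlgebra
    have : Module.Finite (IsLocalRing.ResidueField A) (IsLocalRing.ResidueField A'.1) :=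
      residueFieldMap_finite A'.2
    rw [inertiaDegree_eq_finrank _ _ _ A'.2]
    exact fundamentalEquality_iff B
  have hle' := fun A' (_ : A' ∈ Finset.univ) =>
    Nat.mul_le_mul_left (ramificationIndex (algebraMap K L) A'.1) (hle A')
  simp only [hiff]
  constructor
  · intro h
    have h1 := Finset.sum_le_sum hle'
    refine ⟨h.trans h1, fun A' => ?_⟩
    have h2 := (Finset.sum_eq_sum_iff_of_le hle').mp (h1.antisymm (hA.trans h)) A'
      (Finset.mem_univ _)
    exact (Nat.eq_of_mul_eq_mul_left (ramificationIndex_pos A'.2) h2).ge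
  · rintro ⟨h, h'⟩
    exact h.trans (Finset.sum_le_sum fun A' _ => Nat.mul_le_mul_left _ (h' A'))

section Tower

variable {M : Type*} [Field M]

theorem ramificationIndex_comp_ringHom (f : K →+* L) (g : L →+* M) (C : ValuationSubring M) :
    ramificationIndex (g.comp f) C = ramificationIndex f (C.comap g) * ramificationIndex g C := by
  have hle : (Units.map (g.comp f : K →* M)).range ≤ (Units.map (g : L →* M)).range := by
    rintro _ ⟨x, rfl⟩
    exact ⟨Units.map (f : K →* L) x, rfl⟩
  rw [ramificationIndex_eq_index, ramificationIndex_eq_index g,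
    ← Subgroup.relIndex_mul_index (sup_le_sup_right hle C.unitGroup)]
  congr 1
  rw [ramificationIndex_eq_index, ← sup_eq_left.mpr hle, sup_assoc, Subgroup.relIndex_sup_right,
    ← Subgroup.index_comap]
  congr 1
  ext x
  rw [Subgroup.mem_comap, mem_range_sup_unitGroup_iff, mem_range_sup_unitGroup_iff]
  exact exists_congr fun c => ValuationSubring.valuation_eq_iff_of_comap_eq (f := g) rfl

theorem inertiaDegree_comp_ringHom (f : K →+* L) (g : L →+* M) {A : ValuationSubring K}
    {B : ValuationSubring L} {C : ValuationSubring M} (hB : B.comap f = A) (hC : C.comap g = B) :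
    inertiaDegree (g.comp f) A C = inertiaDegree f A B * inertiaDegree g B C := by
  have h : C.comap (g.comp f) = A := by rw [← hB, ← hC, ValuationSubring.comap_comap]
  rw [inertiaDegree_eq_finrank _ _ _ h, inertiaDegree_eq_finrank _ _ _ hB,
    inertiaDegree_eq_finrank _ _ _ hC]
  let := (residueFieldMap _ _ _ h).toAlgebra
  let := (residueFieldMap _ _ _ hB).toAlgebra
  let := (residueFieldMap _ _ _ hC).toAlgebra
  have : IsScalarTower (IsLocalRing.ResidueField A) (IsLocalRing.ResidueField B)
      (IsLocalRing.ResidueField C) := IsScalarTower.of_algebraMap_eq fun x => by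
    obtain ⟨x, rfl⟩ := IsLocalRing.residue_surjective x
    rfl
  exact (Module.finrank_mul_finrank _ _ _).symm

end Tower

theorem FundamentalEquality.of_tower {M : Type*} [Field M] [Algebra K L] [Algebra K M]
    [Algebra L M] [IsScalarTower K L M] [FiniteDimensional K L] [FiniteDimensional L M]
    {A : ValuationSubring K} (h : FundamentalEquality A M) : FundamentalEquality A L := by
  have hM : FiniteDimensional K M := Module.Finite.trans L M
  have : Finite (prolongations A L) := (prolongations_finite A).to_subtype
  have hunion : prolongations A M = ⋃ B : prolongations A L, prolongations B.1 M := by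
    ext C
    simp only [prolongations, Set.mem_iUnion, Set.mem_ofPred_eq, IsScalarTower.algebraMap_eq K L M,
      ← ValuationSubring.comap_comap]
    exact ⟨fun hC => ⟨⟨_, hC⟩, rfl⟩, fun ⟨B, hB⟩ => hB ▸ B.2⟩
  have hsum : ∑ᶠ C ∈ prolongations A M,
      ramificationIndex (algebraMap K M) C * inertiaDegree (algebraMap K M) A C =
      ∑ᶠ B ∈ prolongations A L,
        (ramificationIndex (algebraMap K L) B * inertiaDegree (algebraMap K L) A B) *
        ∑ᶠ C ∈ prolongations B M,
          ramificationIndex (algebraMap L M) C * inertiaDegree (algebraMap L M) B C := by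
    rw [hunion, finsum_mem_iUnion, ← finsum_set_coe_eq_finsum_mem (prolongations A L)]
    · refine finsum_congr fun B => ?_
      rw [mul_finsum_mem]
      refine finsum_mem_congr rfl fun C hC => ?_
      rw [IsScalarTower.algebraMap_eq K L M, ramificationIndex_comp_ringHom,
        inertiaDegree_comp_ringHom _ _ B.2 hC, show C.comap (algebraMap L M) = B.1 from hC]
      ring
    · intro B₁ B₂ hne
      exact Set.disjoint_left.mpr fun C h₁ h₂ => hne (Subtype.ext (h₁.symm.trans h₂))
    · exact fun B => prolongations_finite B.1
  rw [fundamentalEquality_iff]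
  refine Nat.le_of_mul_le_mul_right ?_ (Module.finrank_pos (R := L) (M := M))
  rw [Module.finrank_mul_finrank, h.2, hsum, finsum_mem_mul,
    finsum_mem_eq_finite_toFinset_sum _ (prolongations_finite A),
    finsum_mem_eq_finite_toFinset_sum _ (prolongations_finite A)]
  exact Finset.sum_le_sum fun B _ =>
    Nat.mul_le_mul_left _ (finsum_ramificationIndex_mul_inertiaDegree_le B)

namespace ValuationSubring

theorem exists_comap_eq (f : K →+* L) (A : ValuationSubring K) :
    ∃ A' : ValuationSubring L, A'.comap f = A := by
  obtain ⟨A', h, hloc⟩ := IsLocalRing.exists_factor_valuationRing (f.comp A.subtype)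
  refine ⟨A', le_antisymm (fun x hx => ?_) fun x hx => h ⟨x, hx⟩⟩
  by_contra hxA
  have hx0 : x ≠ 0 := fun h0 => hxA (h0 ▸ A.zero_mem)
  have hx' := (A.mem_or_inv_mem x).resolve_left hxA
  have hu : IsUnit ((f.comp A.subtype).codRestrict A'.toSubring h ⟨x⁻¹, hx'⟩) := by
    refine IsUnit.of_mul_eq_one (⟨f x, hx⟩ : A'.toSubring) (Subtype.ext ?_)
    change f x⁻¹ * f x = 1
    rw [← map_mul, inv_mul_cancel₀ hx0, map_one]
  obtain ⟨y, hy⟩ := isUnit_iff_exists_inv.mp (hloc.map_nonunit _ hu)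
  have hy' : x⁻¹ * (y : K) = 1 := congrArg Subtype.val hy
  rw [inv_mul_eq_one₀ hx0] at hy'
  exact hxA (hy' ▸ y.2)

theorem isAlgClosed_residueField [IsAlgClosed K] (A : ValuationSubring K) :
    IsAlgClosed (IsLocalRing.ResidueField A) := by
  refine IsAlgClosed.of_exists_root _ fun p hp hirr => ?_
  obtain ⟨q, rfl, hdeg, hq⟩ := Polynomial.lifts_and_natDegree_eq_and_monic
    (Polynomial.map_surjective _ IsLocalRing.residue_surjective p) hp
  obtain ⟨x, hx⟩ := IsAlgClosed.exists_root (q.map (algebraMap A K)) <| by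
    rw [hq.degree_map, ← hq.degree_map (IsLocalRing.residue A)]
    exact hirr.degree_pos.ne'
  rw [Polynomial.IsRoot, Polynomial.eval_map] at hx
  obtain ⟨y, rfl⟩ := IsIntegrallyClosed.isIntegral_iff.mp (⟨q, hq, hx⟩ : IsIntegral A x)
  refine ⟨IsLocalRing.residue A y, ?_⟩
  rw [Polynomial.eval_map, Polynomial.eval₂_hom]
  rw [Polynomial.eval₂_hom, map_eq_zero_iff _ (FaithfulSMul.algebraMap_injective A K)] at hx
  rw [hx, map_zero]

end ValuationSubring

theorem exists_prolongation_residueField_embedding {K : Type u} [Field K] (A : ValuationSubring K)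
    (F : Type*) [Field F] [Algebra (IsLocalRing.ResidueField A) F]
    [FiniteDimensional (IsLocalRing.ResidueField A) F] :
    ∃ (L : Type u) (_ : Field L) (_ : Algebra K L) (_ : FiniteDimensional K L)
      (A' : ValuationSubring L) (h : A'.comap (algebraMap K L) = A)
      (φ : F →+* IsLocalRing.ResidueField A'),
      φ.comp (algebraMap _ F) = residueFieldMap (algebraMap K L) A A' h := by
  obtain ⟨V, hV⟩ := ValuationSubring.exists_comap_eq (algebraMap K (AlgebraicClosure K)) A
  have := V.isAlgClosed_residueField
  let := (residueFieldMap _ A V hV).toAlgebra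
  let φ : F →ₐ[IsLocalRing.ResidueField A] IsLocalRing.ResidueField V := IsAlgClosed.lift
  let b := Module.finBasis (IsLocalRing.ResidueField A) F
  choose a ha using fun i => IsLocalRing.residue_surjective (φ (b i))
  let E := IntermediateField.adjoin K (Set.range fun i => (a i : AlgebraicClosure K))
  have hfin : FiniteDimensional K E := IntermediateField.finiteDimensional_adjoin
    fun x _ => Algebra.IsIntegral.isIntegral x
  have hE : (V.comap (algebraMap E (AlgebraicClosure K))).comap (algebraMap K E) = A := by
    rw [ValuationSubring.comap_comap, ← IsScalarTower.algebraMap_eq, hV]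
  let := (residueFieldMap _ A _ hE).toAlgebra
  let ψ : IsLocalRing.ResidueField (V.comap (algebraMap E (AlgebraicClosure K)))
      →ₐ[IsLocalRing.ResidueField A] IsLocalRing.ResidueField V :=
    { residueFieldMap (algebraMap E (AlgebraicClosure K)) _ V rfl with
      commutes' := fun x => by
        obtain ⟨x, rfl⟩ := IsLocalRing.residue_surjective x
        rfl }
  have hφψ : φ.range ≤ ψ.range := by
    rintro _ ⟨x, rfl⟩
    change φ x ∈ ψ.range
    rw [← b.sum_repr x, map_sum]
    refine sum_mem fun i _ => ?_
    rw [map_smul]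
    refine ψ.range.smul_mem ?_ _
    rw [← ha]
    exact ⟨IsLocalRing.residue _ ⟨⟨a i, IntermediateField.subset_adjoin _ _ ⟨i, rfl⟩⟩, (a i).2⟩,
      rfl⟩
  let χ := (AlgEquiv.ofInjective ψ ψ.injective).symm.toAlgHom.comp
    (φ.codRestrict ψ.range fun x => hφψ ⟨x, rfl⟩)
  exact ⟨E, inferInstance, inferInstance, hfin, _, hE, χ, χ.comp_algebraMap⟩

theorem isDefectless_comp_iff_of_comp {K : Type u} [Field K] (A : ValuationSubring K)
    (B : ValuationSubring (IsLocalRing.ResidueField A)) :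
    IsDefectless (A.comp B) ↔ IsDefectless A ∧ IsDefectless B := by
  refine ⟨fun h => ⟨fun L _ _ _ => ?_, fun F _ _ _ => ?_⟩, fun ⟨hA, hB⟩ L _ _ _ => ?_⟩
  · exact ((fundamentalEquality_comp_iff A B).mp (h L inferInstance)).1
  · obtain ⟨L, _, _, _, A', hA', φ, hφ⟩ := exists_prolongation_residueField_embedding A F
    let := (residueFieldMap (algebraMap K L) A A' hA').toAlgebra
    let := φ.toAlgebra
    have : IsScalarTower (IsLocalRing.ResidueField A) F (IsLocalRing.ResidueField A') :=
      IsScalarTower.of_algebraMap_eq' hφ.symm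
    have : Module.Finite (IsLocalRing.ResidueField A) (IsLocalRing.ResidueField A') :=
      residueFieldMap_finite hA'
    have : FiniteDimensional F (IsLocalRing.ResidueField A') :=
      Module.Finite.of_restrictScalars_finite (IsLocalRing.ResidueField A) _ _
    exact FundamentalEquality.of_tower (M := IsLocalRing.ResidueField A')
      (((fundamentalEquality_comp_iff A B).mp (h L inferInstance)).2 ⟨A', hA'⟩)
  · refine (fundamentalEquality_comp_iff A B).mpr ⟨hA L inferInstance, fun A' => ?_⟩
    let := (residueFieldMap (algebraMap K L) A A' A'.2).toAlgebra
    exact hB _ (residueFieldMap_finite A'.2)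

theorem ValuationSubring.comp_eq_of_coe_eq_image {A B : ValuationSubring K} (hle : A ≤ B)
    {C : ValuationSubring (IsLocalRing.ResidueField B)}
    (hC : (C : Set (IsLocalRing.ResidueField B)) =
      (IsLocalRing.residue B) '' {y : B | (y : K) ∈ A}) : B.comp C = A := by
  obtain ⟨C', rfl⟩ := exists_comp_eq_of_le hle
  congr 1
  refine SetLike.coe_injective (hC.trans ?_)
  simp only [coe_mem_comp]
  exact Set.image_preimage_eq _ IsLocalRing.residue_surjective

/-- Let `O_v ⊆ O_{v0}` be valuation subrings of a field `K`, and let `Ō_v` be the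
image of `O_v` in the residue field `Kv0` of `O_{v0}` (a valuation subring of `Kv0`,
the valuation induced by `v` on `Kv0`).  Then `(K, O_v)` is defectless if and only if
both `(K, O_{v0})` and `(Kv0, Ō_v)` are defectless. -/
theorem isDefectless_comp_iff {K : Type u} [Field K]
    (Ov Ov0 : ValuationSubring K) (hle : Ov ≤ Ov0)
    (Obar : ValuationSubring (IsLocalRing.ResidueField Ov0))
    (hObar : (Obar : Set (IsLocalRing.ResidueField Ov0)) =
      (IsLocalRing.residue Ov0) '' {y : Ov0 | (y : K) ∈ Ov}) :
    IsDefectless Ov ↔ IsDefectless Ov0 ∧ IsDefectless Obar := by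
  obtain rfl := ValuationSubring.comp_eq_of_coe_eq_image hle hObar
  exact isDefectless_comp_iff_of_comp Ov0 Obar
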